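/- Let n ≥ 2 be an integer. There does not exist a compact set K ⊆ ℝ^n with K + ℤ^n = ℝ^n such that (K − K) ∩ ℤ^n is contained in the union of the coordinate axes, i.e. in (ℤ×{0}×…×{0}) ∪ ({0}×ℤ×…×{0}) ∪ … ∪ ({0}×{0}×…×ℤ) = ⋃_{l=1}^{n} ℤ·e_l, where e_l is the l-th standard basis vector. -/

import Mathlib

open Pointwise

/-- The horizontal displacement of the step from `z` to `w` in `ℤ²`, counted only if the step
starts below height `h`. -/
def displacementBelow (h : ℤ) (z w : ℤ × ℤ) : ℤ := if z.2 < h then w.1 - z.1 else 0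

/-- Two points of `ℤ²` lie on a common horizontal or vertical line. -/
def SameLine (z w : ℤ × ℤ) : Prop := z.1 = w.1 ∨ z.2 = w.2

lemma displacementBelow_add (h : ℤ) {z w u : ℤ × ℤ} (hzw : SameLine z w) (hwu : SameLine w u)
    (hzu : SameLine z u) :
    displacementBelow h z w + displacementBelow h w u = displacementBelow h z u := by
  unfold displacementBelow SameLine at *
  grind

/-- A labelling of a strip of the square grid by `ℤ²`, with adjacent labels on a common line and
with the right side labelled as the left side translated by `(1, 0)`, cannot drift from below
height `h` to above it. -/
lemma not_exists_drifting_labelling (p : ℕ → ℕ → ℤ × ℤ) (N : ℕ)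
    (hadj : ∀ a b a' b', a ≤ a' → a' ≤ a + 1 → b ≤ b' → b' ≤ b + 1 →
      SameLine (p a b) (p a' b'))
    (hp : ∀ b, p N b = p 0 b + (1, 0)) (h : ℤ) (B : ℕ)
    (hlow : ∀ a, (p a 0).2 < h) (hhigh : ∀ a, h ≤ (p a B).2) : False := by
  let rowSum (m b : ℕ) : ℤ := ∑ a ∈ Finset.range m, displacementBelow h (p a b) (p (a + 1) b)
  have strip (b m : ℕ) : rowSum m b + displacementBelow h (p m b) (p m (b + 1)) =
      displacementBelow h (p 0 b) (p 0 (b + 1)) + rowSum m (b + 1) := by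
    induction m with
    | zero => simp [rowSum]
    | succ m ih =>
      have lower := displacementBelow_add h (hadj m b (m + 1) b (by omega) le_rfl le_rfl (by omega))
        (hadj (m + 1) b (m + 1) (b + 1) le_rfl (by omega) (by omega) le_rfl)
        (hadj m b (m + 1) (b + 1) (by omega) le_rfl (by omega) le_rfl)
      have upper := displacementBelow_add h (hadj m b m (b + 1) le_rfl (by omega) (by omega) le_rfl)
        (hadj m (b + 1) (m + 1) (b + 1) (by omega) le_rfl le_rfl (by omega))
        (hadj m b (m + 1) (b + 1) (by omega) le_rfl (by omega) le_rfl)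
      simp only [rowSum, Finset.sum_range_succ] at ih ⊢
      linarith
  have const (b : ℕ) : rowSum N b = rowSum N 0 := by
    induction b with
    | zero => rfl
    | succ b ih =>
      have key := strip b N
      have side : displacementBelow h (p N b) (p N (b + 1)) =
          displacementBelow h (p 0 b) (p 0 (b + 1)) := by
        simp [displacementBelow, hp]
      linarith
  have bottom : rowSum N 0 = 1 := by
    simp only [rowSum, displacementBelow, hlow, if_true]
    rw [Finset.sum_range_sub (fun a => (p a 0).1), hp]
    simp
  have top : rowSum N B = 0 :=
    Finset.sum_eq_zero fun a _ => if_neg (hhigh a).not_gt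
  linarith [const B]

/-- If `K + ℤⁿ = ℝⁿ`, the integer vectors carrying points into `K` can be chosen equivariantly
with respect to integer translations. -/
lemma exists_equivariant_label {ι : Type*} {K : Set (ι → ℝ)}
    (hK : ∀ x : ι → ℝ, ∃ y ∈ K, ∃ z : ι → ℤ, x = y + fun i => (z i : ℝ)) :
    ∃ f : (ι → ℝ) → ι → ℤ, (∀ x, (x - fun i => (f x i : ℝ)) ∈ K) ∧
      ∀ x (z : ι → ℤ), f (x + fun i => (z i : ℝ)) = f x + z := by
  choose y hy z hz using hK
  refine ⟨fun x i => z (fun j => Int.fract (x j)) i + ⌊x i⌋, fun x => ?_, fun x w => ?_⟩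
  · convert hy fun j => Int.fract (x j) using 1
    ext i
    have := congrFun (hz fun j => Int.fract (x j)) i
    simp only [Pi.add_apply, Pi.sub_apply, Int.cast_add] at this ⊢
    linarith [Int.self_sub_floor (x i)]
  · ext i
    simp only [Pi.add_apply, Int.fract_add_intCast, Int.floor_add_intCast]
    ring

/-- A compact set that avoids a set of integer vectors stays at positive distance from it. -/
lemma exists_forall_le_dist_intCast_of_isCompact {ι : Type*} [Fintype ι] {C : Set (ι → ℝ)}
    (hC : IsCompact C) (S : Set (ι → ℤ)) (hS : ∀ z ∈ S, (fun i => (z i : ℝ)) ∉ C) :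
    ∃ δ > 0, ∀ z ∈ S, ∀ v ∈ C, δ ≤ dist v fun i => (z i : ℝ) := by
  have hclosed : IsClosed ((fun (z : ι → ℤ) i => (z i : ℝ)) '' S) := by
    refine (Topology.IsClosedEmbedding.isClosedMap ?_) S (isClosed_discrete S)
    exact Topology.IsClosedEmbedding.piMap fun _ => Int.isClosedEmbedding_coe_real
  have hdisj : Disjoint C ((fun (z : ι → ℤ) i => (z i : ℝ)) '' S) := by
    rw [Set.disjoint_right]
    rintro _ ⟨z, hz, rfl⟩
    exact hS z hz
  obtain ⟨δ, hδ, hd⟩ := hdisj.exists_thickenings hC hclosed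
  refine ⟨δ, hδ, fun z hz v hv => ?_⟩
  by_contra! hlt
  refine Set.disjoint_left.1 hd (Metric.self_subset_thickening hδ C hv) ?_
  exact Metric.mem_thickening_iff.2 ⟨_, ⟨z, hz, rfl⟩, hlt⟩

/-- For n ≥ 2 there is no compact set `K ⊆ ℝⁿ` with `K + ℤⁿ = ℝⁿ`
such that `(K - K) ∩ ℤⁿ` is contained in the union of the coordinate axes. -/
theorem no_Nset_with_differences_on_axes (n : ℕ) (hn : 2 ≤ n) :
    ¬ ∃ K : Set (Fin n → ℝ), IsCompact K ∧
      (∀ x : Fin n → ℝ, ∃ y ∈ K, ∃ z : Fin n → ℤ, x = y + fun i => (z i : ℝ)) ∧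
      (∀ v : Fin n → ℝ, v ∈ K - K → (∀ i, ∃ m : ℤ, v i = (m : ℝ)) →
        ∃ l : Fin n, ∀ i : Fin n, i ≠ l → v i = 0) := by
  rintro ⟨K, hK, hcover, haxes⟩
  obtain ⟨m, rfl⟩ := Nat.exists_eq_add_of_le' hn
  obtain ⟨f, hfK, hf⟩ := exists_equivariant_label hcover
  have hKK : IsCompact (K - K) := by
    rw [sub_eq_add_neg]
    exact hK.add hK.neg
  obtain ⟨δ, hδ, hsep⟩ := exists_forall_le_dist_intCast_of_isCompact hKK
    {z : Fin (m + 2) → ℤ | z 0 ≠ 0 ∧ z 1 ≠ 0} (by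
      rintro z ⟨h0, h1⟩ hz
      obtain ⟨l, hl⟩ := haxes _ hz fun i => ⟨z i, rfl⟩
      by_cases h : l = 0
      · exact h1 (by exact_mod_cast hl 1 (by simp [h]))
      · exact h0 (by exact_mod_cast hl 0 (Ne.symm h)))
  have hline (x y : Fin (m + 2) → ℝ) (hxy : dist x y < δ) :
      SameLine (f x 0, f x 1) (f y 0, f y 1) := by
    by_contra hne
    simp only [SameLine, not_or] at hne
    refine (hsep (f y - f x) ⟨by simp; omega, by simp; omega⟩ _
      (Set.sub_mem_sub (hfK x) (hfK y))).not_gt ?_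
    refine lt_of_eq_of_lt ?_ hxy
    rw [dist_eq_norm, dist_eq_norm]
    congr 1
    ext i
    simp only [Pi.sub_apply, Int.cast_sub]
    ring
  obtain ⟨R, hR⟩ := hK.isBounded.exists_norm_le
  have hbound (x : Fin (m + 2) → ℝ) : |x 1 - f x 1| ≤ R :=
    (norm_le_pi_norm _ 1).trans (hR _ (hfK x))
  obtain ⟨k, hk⟩ := exists_nat_one_div_lt hδ
  let N := k + 1
  have hN : (0 : ℝ) < N := by positivity
  have hstep {a a' : ℕ} (h : a ≤ a') (h' : a' ≤ a + 1) : |(a : ℝ) / N - a' / N| ≤ 1 / N := by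
    have h₁ : (a : ℝ) ≤ a' := by exact_mod_cast h
    have h₂ : (a' : ℝ) ≤ a + 1 := by exact_mod_cast h'
    rw [← sub_div, abs_div, abs_of_pos hN]
    gcongr
    rw [abs_le]
    constructor <;> linarith
  let x (a b : ℕ) : Fin (m + 2) → ℝ := Pi.single 0 ((a : ℝ) / N) + Pi.single 1 ((b : ℝ) / N)
  have hx (a b : ℕ) : x a b 1 = b / N := by simp [x]
  obtain ⟨h, hh⟩ := exists_nat_gt R
  refine not_exists_drifting_labelling (fun a b => (f (x a b) 0, f (x a b) 1)) N
    (fun a b a' b' ha ha' hb hb' => hline _ _ ?_) (fun b => ?_) h (N * (2 * h))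
    (fun a => ?_) (fun a => ?_)
  · refine lt_of_le_of_lt ?_ (show 1 / (N : ℝ) < δ by simpa [N] using hk)
    refine (dist_pi_le_iff (by positivity)).2 fun i => ?_
    rw [Real.dist_eq]
    refine Fin.cases ?_ (fun i => Fin.cases ?_ (fun i => ?_) i) i
    · simpa [x] using hstep ha ha'
    · simpa [x] using hstep hb hb'
    · have h₁ : i.succ.succ ≠ 1 := fun h => by simpa using congrArg Fin.val h
      simp [x, h₁]
  · have hshift : x N b = x 0 b + fun i => ((Pi.single 0 1 : Fin (m + 2) → ℤ) i : ℝ) := by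
      ext i
      by_cases h : i = 0
      · subst h
        simp [x, hN.ne']
      · simp [x, Pi.single_apply, h]
    simp [hshift, hf]
  · have := (abs_le.1 (hbound (x a 0))).1
    rw [hx] at this
    simp only [CharP.cast_eq_zero, zero_div] at this
    have : (f (x a 0) 1 : ℝ) < h := by linarith
    exact_mod_cast this
  · have := (abs_le.1 (hbound (x a (N * (2 * h))))).2
    rw [hx, Nat.cast_mul, mul_div_cancel_left₀ _ hN.ne'] at this
    push_cast at this
    have : (h : ℝ) ≤ f (x a (N * (2 * h))) 1 := by linarith
    exact_mod_cast this
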